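/- Let A be a Hermitian matrix written in block form A = [A_{ij}]_{i,j=1}^k, where the diagonal blocks A_{ii} are square (so A_{ii} is the principal submatrix of A on the i-th block of indices). For every real number p ≥ 1, the negative p-energy is super-additive over the diagonal blocks: E_p^-(A) ≥ Σ_{i=1}^k E_p^-(A_{ii}). -/

import Mathlib

open Matrix Finset

/-- The negative `p`-energy of a Hermitian matrix: the sum of the `p`-th powers of the
absolute values of its negative eigenvalues (counted with multiplicity). -/
noncomputable def negEnergy {m : Type*} [Fintype m] [DecidableEq m] {A : Matrix m m ℂ}
    (hA : A.IsHermitian) (p : ℝ) : ℝ :=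
  ∑ i, if hA.eigenvalues i < 0 then |hA.eigenvalues i| ^ p else 0

/-- `x ↦ (x⁻)^p`, the function whose trace is the negative `p`-energy, is convex. -/
lemma convexOn_negPart_rpow {p : ℝ} (hp : 1 ≤ p) :
    ConvexOn ℝ Set.univ (fun x : ℝ => if x < 0 then |x| ^ p else 0) := by
  have h : (fun x : ℝ => if x < 0 then |x| ^ p else 0) = fun x => (max (-x) 0) ^ p := by
    funext x
    split_ifs with hx
    · rw [abs_of_neg hx, max_eq_left (by linarith)]
    · rw [max_eq_right (by linarith), Real.zero_rpow (by linarith)]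
  rw [h]
  refine ⟨convex_univ, fun x _ y _ a b ha hb hab => ?_⟩
  have hconv := (convexOn_rpow hp).2 (le_max_right (-x) 0) (le_max_right (-y) 0) ha hb hab
  refine le_trans (Real.rpow_le_rpow (le_max_right _ _) ?_ (by linarith)) hconv
  simp only [smul_eq_mul]
  refine max_le ?_ (by positivity)
  nlinarith [mul_le_mul_of_nonneg_left (le_max_left (-x) 0) ha,
    mul_le_mul_of_nonneg_left (le_max_left (-y) 0) hb]

/-- Peierls' inequality for a unitarily diagonalized matrix. -/
lemma sum_convex_diag_conj_le {n : Type*} [Fintype n] [DecidableEq n] {f : ℝ → ℝ}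
    (hf : ConvexOn ℝ Set.univ f) {Q : Matrix n n ℂ} (hQ : Q ∈ unitaryGroup n ℂ) (d : n → ℝ) :
    ∑ s, f ((Q * diagonal (fun t => (d t : ℂ)) * star Q) s s).re ≤ ∑ t, f (d t) := by
  have hrow (s : n) : ∑ t, Complex.normSq (Q s t) = 1 := by
    have h := congr_fun (congr_fun (mem_unitaryGroup_iff.mp hQ) s) s
    simp only [mul_apply, star_apply, RCLike.star_def, Complex.mul_conj, one_apply_eq] at h
    exact_mod_cast h
  have hcol (t : n) : ∑ s, Complex.normSq (Q s t) = 1 := by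
    have h := congr_fun (congr_fun (mem_unitaryGroup_iff'.mp hQ) t) t
    simp only [mul_apply, star_apply, RCLike.star_def, ← Complex.normSq_eq_conj_mul_self,
      one_apply_eq] at h
    exact_mod_cast h
  have hdiag (s : n) : ((Q * diagonal (fun t => (d t : ℂ)) * star Q) s s).re =
      ∑ t, Complex.normSq (Q s t) * d t := by
    rw [mul_apply, Complex.re_sum]
    refine sum_congr rfl fun t _ => ?_
    rw [mul_diagonal, star_apply, RCLike.star_def, mul_right_comm, Complex.mul_conj,
      ← Complex.ofReal_mul, Complex.ofReal_re]
  calc ∑ s, f ((Q * diagonal (fun t => (d t : ℂ)) * star Q) s s).re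
      ≤ ∑ s, ∑ t, Complex.normSq (Q s t) * f (d t) := by
        refine sum_le_sum fun s _ => ?_
        rw [hdiag]
        exact hf.map_sum_le (fun t _ => Complex.normSq_nonneg _) (hrow s)
          (fun _ _ => Set.mem_univ _)
    _ = ∑ t, f (d t) := by
        rw [sum_comm]
        simp_rw [← sum_mul, hcol, one_mul]

/-- Peierls' inequality: the trace of a convex function of a Hermitian matrix dominates the sum
of its values at the diagonal entries in any orthonormal basis. -/
lemma sum_convex_diag_le_sum_eigenvalues {n : Type*} [Fintype n] [DecidableEq n] {f : ℝ → ℝ}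
    (hf : ConvexOn ℝ Set.univ f) {A : Matrix n n ℂ} (hA : A.IsHermitian)
    {W : Matrix n n ℂ} (hW : W ∈ unitaryGroup n ℂ) :
    ∑ s, f ((star W * A * W) s s).re ≤ ∑ t, f (hA.eigenvalues t) := by
  have hQ : star W * (hA.eigenvectorUnitary : Matrix n n ℂ) ∈ unitaryGroup n ℂ :=
    mul_mem (Unitary.star_mem hW) hA.eigenvectorUnitary.2
  have hconj : star W * A * W =
      star W * (hA.eigenvectorUnitary : Matrix n n ℂ) *
        diagonal (fun t => (hA.eigenvalues t : ℂ)) *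
        star (star W * (hA.eigenvectorUnitary : Matrix n n ℂ)) := by
    conv_lhs => rw [hA.spectral_theorem, Unitary.conjStarAlgAut_apply]
    simp only [star_mul, star_star, Matrix.mul_assoc]
    rfl
  rw [hconj]
  exact sum_convex_diag_conj_le hf hQ hA.eigenvalues

/-- A block diagonal matrix with unitary blocks is unitary. -/
lemma blockDiagonal'_mem_unitaryGroup {o : Type*} {m : o → Type*} [Fintype o] [DecidableEq o]
    [∀ i, Fintype (m i)] [∀ i, DecidableEq (m i)] {V : ∀ i, Matrix (m i) (m i) ℂ}
    (hV : ∀ i, V i ∈ unitaryGroup (m i) ℂ) :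
    blockDiagonal' V ∈ unitaryGroup (Σ i, m i) ℂ := by
  rw [mem_unitaryGroup_iff, star_eq_conjTranspose, blockDiagonal'_conjTranspose,
    ← blockDiagonal'_mul, ← blockDiagonal'_one]
  exact congr_arg blockDiagonal' (funext fun i => mem_unitaryGroup_iff.mp (hV i))

/-- The diagonal blocks of a conjugate by a block diagonal matrix. -/
lemma star_blockDiagonal'_mul_mul_apply {o : Type*} {m : o → Type*} [Fintype o] [DecidableEq o]
    [∀ i, Fintype (m i)] (V : ∀ i, Matrix (m i) (m i) ℂ)
    (A : Matrix (Σ i, m i) (Σ i, m i) ℂ) (i : o) (a b : m i) :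
    (star (blockDiagonal' V) * A * blockDiagonal' V) ⟨i, a⟩ ⟨i, b⟩ =
      (star (V i) * A.submatrix (Sigma.mk i) (Sigma.mk i) * V i) a b := by
  have hV (l : o) (c : m l) (b : m i) (h : l ≠ i) : blockDiagonal' V ⟨l, c⟩ ⟨i, b⟩ = 0 :=
    blockDiagonal'_apply_ne V c b h
  simp only [mul_apply, Fintype.sum_sigma, star_apply, submatrix_apply]
  rw [sum_eq_single i (fun l _ hl => sum_eq_zero fun c _ => by rw [hV l c b hl, mul_zero])
    (by simp)]
  refine sum_congr rfl fun c _ => ?_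
  rw [blockDiagonal'_apply_eq,
    sum_eq_single i (fun l _ hl => sum_eq_zero fun e _ => by rw [hV l e a hl, star_zero, zero_mul])
      (by simp)]
  simp only [blockDiagonal'_apply_eq]

/-- Super-additivity of the negative `p`-energy over the diagonal blocks of a Hermitian
block matrix. -/
theorem negEnergy_superadditive {k : ℕ} {m : Fin k → Type*}
    [∀ i, Fintype (m i)] [∀ i, DecidableEq (m i)]
    (A : Matrix (Σ i, m i) (Σ i, m i) ℂ) (hA : A.IsHermitian) (p : ℝ) (hp : 1 ≤ p) :
    ∑ i, negEnergy (hA.submatrix (Sigma.mk i)) p ≤ negEnergy hA p := by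
  set V : ∀ i, Matrix (m i) (m i) ℂ :=
    fun i => ((hA.submatrix (Sigma.mk i)).eigenvectorUnitary : Matrix (m i) (m i) ℂ) with hV
  have h := sum_convex_diag_le_sum_eigenvalues (convexOn_negPart_rpow hp) hA
    (blockDiagonal'_mem_unitaryGroup (V := V)
      fun i => (hA.submatrix (Sigma.mk i)).eigenvectorUnitary.2)
  rw [Fintype.sum_sigma] at h
  refine le_of_eq_of_le (sum_congr rfl fun i _ => sum_congr rfl fun a _ => ?_) h
  have hdiag : ((star (V i) * A.submatrix (Sigma.mk i) (Sigma.mk i) * V i) a a).re =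
      (hA.submatrix (Sigma.mk i)).eigenvalues a := by
    have := (hA.submatrix (Sigma.mk i)).conjStarAlgAut_star_eigenvectorUnitary
    rw [Unitary.conjStarAlgAut_star_apply] at this
    rw [hV, this, diagonal_apply_eq]
    rfl
  rw [star_blockDiagonal'_mul_mul_apply, hdiag]
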